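/- There is no binary linear [324, 10, 160] code. Equivalently: every F₂-linear subspace C of F₂^324 of dimension 10 contains a nonzero codeword of Hamming weight at most 159. -/

import Mathlib

/-- The nontrivial sign character of `ZMod 2`, with integer values. -/
def sgn2 (a : ZMod 2) : ℤ := if a = 0 then 1 else -1

lemma sgn2_add (a b : ZMod 2) : sgn2 (a + b) = sgn2 a * sgn2 b := by
  revert a b; decide

lemma sgn2_zero : sgn2 0 = 1 := by decide

/-- The message space. -/
abbrev V10 := Fin 10 → ZMod 2

/-- The pairing sign. -/
def chi (x c : V10) : ℤ := sgn2 (x ⬝ᵥ c)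

lemma chi_add_left (x y c : V10) : chi (x + y) c = chi x c * chi y c := by
  simp [chi, add_dotProduct, sgn2_add]

lemma chi_add_right (x c d : V10) : chi x (c + d) = chi x c * chi x d := by
  simp [chi, dotProduct_add, sgn2_add]

lemma chi_comm (x c : V10) : chi x c = chi c x := by
  simp [chi, dotProduct_comm]

lemma card_V10 : (Finset.univ : Finset V10).card = 1024 := by
  simp [ZMod.card]

lemma sum_chi (c : V10) : ∑ x : V10, chi x c = if c = 0 then 1024 else 0 := by
  split_ifs with h
  · subst h
    simp [chi, sgn2_zero]
  · obtain ⟨j, hj⟩ : ∃ j, c j ≠ 0 := by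
      by_contra hcon
      push Not at hcon
      exact h (funext hcon)
    have h1 : chi (Pi.single j 1) c = -1 := by
      simp [chi, sgn2, hj]
    have h2 : ∑ x : V10, chi (x + Pi.single j 1) c = ∑ x : V10, chi x c :=
      Equiv.sum_comp (Equiv.addRight (Pi.single j 1 : V10)) (fun x => chi x c)
    simp only [chi_add_left, h1, ← Finset.sum_mul] at h2
    linarith

lemma sum_chi' (c : V10) : ∑ x : V10, chi c x = if c = 0 then 1024 else 0 := by
  rw [← sum_chi]
  exact Finset.sum_congr rfl fun x _ => chi_comm _ _

/-- A nonnegative function has nonnegative third moment of its Fourier transform. -/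
lemma cube_nonneg (G : V10 → ℤ) (hG : ∀ c, 0 ≤ G c) :
    0 ≤ ∑ x : V10, (∑ c : V10, G c * chi x c) ^ 3 := by
  have h : ∀ x : V10, (∑ c : V10, G c * chi x c) ^ 3
      = ∑ a : V10, ∑ b : V10, ∑ c : V10, G a * G b * G c * chi x (a + b + c) := by
    intro x
    rw [pow_three', Finset.sum_mul_sum, Finset.sum_mul]
    refine Finset.sum_congr rfl fun a _ => ?_
    rw [Finset.sum_mul]
    refine Finset.sum_congr rfl fun b _ => ?_
    rw [Finset.mul_sum]
    refine Finset.sum_congr rfl fun c _ => ?_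
    rw [chi_add_right, chi_add_right]
    ring
  simp only [h]
  rw [Finset.sum_comm]
  refine Finset.sum_nonneg fun a _ => ?_
  rw [Finset.sum_comm]
  refine Finset.sum_nonneg fun b _ => ?_
  rw [Finset.sum_comm]
  refine Finset.sum_nonneg fun c _ => ?_
  rw [← Finset.mul_sum, sum_chi]
  have := mul_nonneg (mul_nonneg (hG a) (hG b)) (hG c)
  split_ifs
  · positivity
  · simp

/-- The combinatorial core, in terms of the columns of a generator matrix. -/
lemma core (col : Fin 324 → V10)
    (h : ∀ c : V10, c ≠ 0 → ∑ i, chi (col i) c ≤ 4) : False := by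
  classical
  -- multiplicity of a column
  let f : V10 → ℕ := fun x => (Finset.univ.filter fun i => col i = x).card
  let G : V10 → ℤ := fun c => 4 - ∑ i, chi (col i) c + if c = 0 then 320 else 0
  have hG : ∀ c, 0 ≤ G c := by
    intro c
    by_cases hc : c = 0
    · subst hc
      simp [G, chi, sgn2_zero]
    · have := h c hc
      simp only [G, if_neg hc]
      linarith
  have hf : ∑ x, (f x : ℤ) = 324 := by
    have := Finset.card_eq_sum_card_fiberwise (s := (Finset.univ : Finset (Fin 324)))
      (t := (Finset.univ : Finset V10)) (f := col) (by intro x _; simp)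
    simp only [Finset.card_univ, Fintype.card_fin] at this
    simp only [f]
    exact_mod_cast this.symm
  have hhat : ∀ x : V10, ∑ c, G c * chi x c
      = 320 + (if x = 0 then 4096 else 0) - 1024 * (f x : ℤ) := by
    intro x
    have e1 : ∀ c, G c * chi x c = 4 * chi x c - ∑ i, chi (col i + x) c
        + if c = 0 then 320 else 0 := by
      intro c
      simp only [G, chi_add_left, ← Finset.sum_mul]
      by_cases hc : c = 0
      · subst hc
        simp [chi, sgn2_zero]
      · simp [hc]; ring
    have e2 : ∑ c, ∑ i, chi (col i + x) c = 1024 * (f x : ℤ) := by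
      rw [Finset.sum_comm]
      simp only [sum_chi']
      have e3 : ∀ i, (col i + x = 0) ↔ col i = x := by
        intro i
        rw [add_eq_zero_iff_eq_neg]
        have : -x = x := by
          funext j
          simp
        rw [this]
      simp only [e3, f, ← Finset.sum_filter, Finset.sum_const]
      simp [mul_comm]
    simp only [e1, Finset.sum_add_distrib, Finset.sum_sub_distrib, ← Finset.mul_sum, sum_chi', e2]
    simp only [Finset.sum_ite_eq', Finset.mem_univ, if_true]
    split_ifs <;> ring
  have key := cube_nonneg G hG
  simp only [hhat] at key
  -- pointwise bound
  have hb : ∀ x : V10, (320 + (if x = 0 then 4096 else 0) - 1024 * (f x : ℤ)) ^ 3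
      ≤ 262144 * (125 - 1456 * (f x : ℤ) + if x = 0 then 328384 else 0) := by
    intro x
    generalize f x = m
    have hm1 : (0 : ℤ) ≤ m * (m - 1) := by
      rcases Nat.eq_zero_or_pos m with h0 | h0
      · simp [h0]
      · have : (1 : ℤ) ≤ m := by exact_mod_cast h0
        nlinarith
    have hm0 : (0 : ℤ) ≤ m := Int.natCast_nonneg m
    split_ifs
    · have e' : 262144 * (125 - 1456 * (m : ℤ) + 328384) - (320 + 4096 - 1024 * (m : ℤ)) ^ 3
          = 262144 * (m * (16 * (69 - 16 * (m : ℤ)) ^ 2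
            + 16 * 69 * (69 - 16 * (m : ℤ)) + 16 * 69 ^ 2 - 1456)) := by ring
      have : (0 : ℤ) ≤ 16 * (69 - 16 * (m : ℤ)) ^ 2
            + 16 * 69 * (69 - 16 * (m : ℤ)) + 16 * 69 ^ 2 - 1456 := by
        nlinarith [sq_nonneg (2 * (69 - 16 * (m : ℤ)) + 69)]
      have := mul_nonneg hm0 this
      linarith
    · have e' : 262144 * (125 - 1456 * (m : ℤ) + 0) - (320 + 0 - 1024 * (m : ℤ)) ^ 3
          = 262144 * (m * (m - 1) * (256 * (16 * m + 1))) := by ring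
      have : (0 : ℤ) ≤ m * (m - 1) * (256 * (16 * m + 1)) := mul_nonneg hm1 (by linarith)
      linarith
  have hs := Finset.sum_le_sum (s := Finset.univ) fun x _ => hb x
  rw [← Finset.mul_sum, Finset.sum_add_distrib, Finset.sum_sub_distrib, ← Finset.mul_sum, hf,
    Finset.sum_const, card_V10] at hs
  simp only [Finset.sum_ite_eq', Finset.mem_univ, if_true] at hs
  norm_num at hs
  linarith

/-- There is no binary linear [324, 10, 160] code: every `ZMod 2`-linear subspace of
`Fin 324 → ZMod 2` of dimension 10 contains a nonzero codeword of Hamming weight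
at most 159. -/
theorem no_binary_linear_code_324_10_160
    (C : Submodule (ZMod 2) (Fin 324 → ZMod 2))
    (hdim : Module.finrank (ZMod 2) C = 10) :
    ∃ c ∈ C, c ≠ 0 ∧ hammingNorm c ≤ 159 := by
  by_contra hcon
  push Not at hcon
  let b : Module.Basis (Fin 10) (ZMod 2) C := Module.finBasisOfFinrankEq (ZMod 2) C hdim
  refine core (fun i j => (b j : Fin 324 → ZMod 2) i) ?_
  intro c hc
  let w : C := b.equivFun.symm c
  have hw0 : (w : Fin 324 → ZMod 2) ≠ 0 := by
    intro h0
    apply hc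
    have : w = 0 := Subtype.ext h0
    exact (LinearEquiv.map_eq_zero_iff b.equivFun.symm).1 this
  have hwt := hcon w w.2 hw0
  have hval : ∀ i, (fun j => (b j : Fin 324 → ZMod 2) i) ⬝ᵥ c = (w : Fin 324 → ZMod 2) i := by
    intro i
    simp [w, Module.Basis.equivFun_symm_apply, dotProduct, Finset.sum_apply, mul_comm]
  have hsum : ∑ i, chi (fun j => (b j : Fin 324 → ZMod 2) i) c
      = ∑ i, (1 - 2 * (if (w : Fin 324 → ZMod 2) i ≠ 0 then (1 : ℤ) else 0)) := by
    refine Finset.sum_congr rfl fun i _ => ?_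
    rw [chi, hval, sgn2]
    by_cases h : (w : Fin 324 → ZMod 2) i = 0 <;> simp [h]
  have hn : ∑ i, (if (w : Fin 324 → ZMod 2) i ≠ 0 then (1 : ℤ) else 0)
      = (hammingNorm (w : Fin 324 → ZMod 2) : ℤ) := by
    rw [hammingNorm, Finset.sum_boole]
  rw [hsum, Finset.sum_sub_distrib, ← Finset.mul_sum, hn]
  simp
  omega
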